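/- Suppose k, t₁, …, t_m ∈ ℂ satisfy the continuous Bethe ansatz equations: for each s = 0, …, 3 and each j = 1, …, g_s, the (2j−1)-st derivative of the function z ↦ ψ(z)·exp(−mη_s·z) vanishes at z = ω_s. Assume also t_i + t_j ∉ 2Γ for all 1 ≤ i ≠ j ≤ m. Then φ = ψ/w is an eigenfunction of the BC₁ Heun (Treibich–Verdier) operator: there exists ε ∈ ℂ such that for every z ∈ ℂ with σ_p(z) ≠ 0 for all p = 0, …, 3, one has −φ″(z) + (Σ_{p=0}^{3} g_p(g_p + 1)·℘(z + ω_p))·φ(z) = ε·φ(z). -/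

import Mathlib

open Filter Topology

namespace HeunBethe

/-- `f` agrees near `a`, but possibly not at `a`, with a function analytic at `a`. -/
def RemovableAt (f : ℂ → ℂ) (a : ℂ) : Prop :=
  ∃ G, AnalyticAt ℂ G a ∧ f =ᶠ[𝓝[≠] a] G

theorem eventually_nhdsNE_add_left {c a : ℂ} {p : ℂ → Prop} :
    (∀ᶠ x in 𝓝[≠] a, p (c + x)) ↔ ∀ᶠ z in 𝓝[≠] (c + a), p z := by
  rw [← map_add_left_nhdsNE, eventually_map]

theorem eventually_nhdsNE_neg {a : ℂ} {p : ℂ → Prop} :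
    (∀ᶠ x in 𝓝[≠] a, p (-x)) ↔ ∀ᶠ z in 𝓝[≠] (-a), p z := by
  rw [← neg_nhdsNE, ← Filter.map_neg, eventually_map]

theorem RemovableAt.congr {f f' : ℂ → ℂ} {a : ℂ} (hf : RemovableAt f a)
    (h : f' =ᶠ[𝓝[≠] a] f) : RemovableAt f' a :=
  hf.imp fun _ hG ↦ ⟨hG.1, h.trans hG.2⟩

theorem _root_.AnalyticAt.removableAt {f : ℂ → ℂ} {a : ℂ} (hf : AnalyticAt ℂ f a) :
    RemovableAt f a :=
  ⟨f, hf, EventuallyEq.rfl⟩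

theorem RemovableAt.add {f f' : ℂ → ℂ} {a : ℂ} (hf : RemovableAt f a) (hf' : RemovableAt f' a) :
    RemovableAt (fun z ↦ f z + f' z) a := by
  obtain ⟨G, hG, e⟩ := hf
  obtain ⟨G', hG', e'⟩ := hf'
  exact ⟨fun z ↦ G z + G' z, hG.fun_add hG', e.add e'⟩

theorem RemovableAt.sub {f f' : ℂ → ℂ} {a : ℂ} (hf : RemovableAt f a) (hf' : RemovableAt f' a) :
    RemovableAt (fun z ↦ f z - f' z) a := by
  obtain ⟨G, hG, e⟩ := hf
  obtain ⟨G', hG', e'⟩ := hf'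
  exact ⟨fun z ↦ G z - G' z, hG.fun_sub hG', e.sub e'⟩

theorem RemovableAt.const_mul {f : ℂ → ℂ} {a : ℂ} (c : ℂ) (hf : RemovableAt f a) :
    RemovableAt (fun z ↦ c * f z) a := by
  obtain ⟨G, hG, e⟩ := hf
  exact ⟨fun z ↦ c * G z, analyticAt_const.fun_mul hG, (EventuallyEq.refl _ fun _ ↦ c).mul e⟩

theorem RemovableAt.sum {ι : Type*} {f : ι → ℂ → ℂ} {a : ℂ} (s : Finset ι)
    (h : ∀ i ∈ s, RemovableAt (f i) a) : RemovableAt (fun z ↦ ∑ i ∈ s, f i z) a := by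
  classical
  induction s using Finset.induction_on with
  | empty => simpa using (analyticAt_const (𝕜 := ℂ) (v := (0 : ℂ)) (x := a)).removableAt
  | insert i s hi ih =>
    simp only [Finset.sum_insert hi]
    exact (h i (by simp)).add (ih fun j hj ↦ h j (by simp [hj]))

theorem RemovableAt.comp_const_add {f : ℂ → ℂ} {c a : ℂ} (h : RemovableAt f (c + a)) :
    RemovableAt (fun x ↦ f (c + x)) a := by
  obtain ⟨G, hG, e⟩ := h
  refine ⟨fun x ↦ G (c + x), ?_, eventually_nhdsNE_add_left.2 e⟩
  exact hG.fun_comp (f := fun x ↦ c + x) (by fun_prop)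

theorem removableAt_comp_const_add_zero {f : ℂ → ℂ} {c : ℂ} :
    RemovableAt (fun x ↦ f (c + x)) 0 ↔ RemovableAt f c := by
  refine ⟨fun h ↦ ?_, fun h ↦ RemovableAt.comp_const_add (by simpa using h)⟩
  simpa using RemovableAt.comp_const_add (f := fun x ↦ f (c + x)) (c := -c) (a := c)
    (by simpa using h)

theorem removableAt_periodic {F : ℂ → ℂ} {c : ℂ}
    (h : ∀ a, ∀ᶠ z in 𝓝[≠] a, F (z + c) = F z) :
    Function.Periodic (RemovableAt F) c := by
  intro a
  apply propext
  rw [add_comm a c]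
  constructor
  · intro H
    exact H.comp_const_add.congr ((h a).mono fun z hz ↦ by simp only [add_comm c z, hz])
  · intro H
    rw [← removableAt_comp_const_add_zero] at H ⊢
    refine H.congr ?_
    have := (eventually_nhdsNE_add_left (c := a) (a := 0)).2 (by simpa using h a)
    filter_upwards [this] with z hz
    rw [← hz]; ring_nf

/-- **Liouville's theorem for elliptic functions**, up to removable singularities. -/
theorem exists_eventually_eq_const_of_removable (L : PeriodPair) {F : ℂ → ℂ}
    (hF : ∀ a, RemovableAt F a)
    (h1 : ∀ a, ∀ᶠ z in 𝓝[≠] a, F (z + 2 * L.ω₁) = F z)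
    (h2 : ∀ a, ∀ᶠ z in 𝓝[≠] a, F (z + 2 * L.ω₂) = F z) :
    ∃ c, ∀ a, ∀ᶠ z in 𝓝[≠] a, F z = c := by
  choose G hG hFG using hF
  set h : ℂ → ℂ := fun a ↦ G a a with hh
  have hlim (a : ℂ) : Tendsto F (𝓝[≠] a) (𝓝 (h a)) :=
    ((hG a).continuousAt.tendsto.mono_left nhdsWithin_le_nhds).congr' (hFG a).symm
  have hhG (a : ℂ) : h =ᶠ[𝓝 a] G a := by
    have e1 : ∀ᶠ z in 𝓝 a, AnalyticAt ℂ (G a) z := (hG a).eventually_analyticAt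
    have e2 : ∀ᶠ z in 𝓝[≠] a, ∀ᶠ y in 𝓝 z, F y = G a y :=
      eventually_nhdsNE_eventually_nhds_iff.2 (hFG a)
    refine eventuallyEq_nhds_of_eventuallyEq_nhdsNE (f := h) (g := G a) ?_ rfl
    filter_upwards [e1.filter_mono nhdsWithin_le_nhds, e2] with z hz1 hz2
    exact tendsto_nhds_unique (hlim z) <|
      (hz1.continuousAt.tendsto.mono_left nhdsWithin_le_nhds).congr'
        ((hz2.filter_mono nhdsWithin_le_nhds).mono fun y hy ↦ hy.symm)
  have hdiff : Differentiable ℂ h := fun a ↦ ((hG a).congr (hhG a).symm).differentiableAt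
  have key (c : ℂ) (hc : ∀ a, ∀ᶠ z in 𝓝[≠] a, F (z + c) = F z) : Function.Periodic h c := by
    intro a
    refine tendsto_nhds_unique ?_ ((hlim a).congr' ((hc a).mono fun z hz ↦ hz.symm))
    have := hlim (a + c)
    rw [← map_add_right_nhdsNE] at this
    exact this
  have p1 := key _ h1
  have p2 := key _ h2
  have hd2 : Differentiable ℂ fun z ↦ h (2 * z) := by fun_prop
  obtain ⟨c, hc⟩ := hd2.exists_const_forall_eq_of_bounded
    (IsZLattice.isCompact_range_of_periodic L.lattice _ hd2.continuous (by
      intro z w hw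
      obtain ⟨m, n, rfl⟩ := PeriodPair.mem_lattice.1 hw
      have := (p2.int_mul n) (2 * z + m * (2 * L.ω₁))
      rw [(p1.int_mul m)] at this
      rw [← this]
      ring_nf)).isBounded
  refine ⟨c, fun a ↦ ?_⟩
  filter_upwards [hFG a, (hhG a).filter_mono nhdsWithin_le_nhds] with z hz1 hz2
  rw [hz1, ← hz2, ← hc (z / 2)]
  congr 1; ring

theorem hasDerivAt_pow_inv (g : ℕ) {x : ℂ} (hx : x ≠ 0) :
    HasDerivAt (fun y : ℂ ↦ (y ^ g)⁻¹) (-(g : ℂ) * (x ^ (g + 1))⁻¹) x := by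
  have := (hasDerivAt_pow g x).fun_inv (pow_ne_zero g hx)
  convert! this using 1
  cases g with
  | zero => simp
  | succ n => field_simp; simp only [Nat.add_sub_cancel]; ring

theorem exists_eq_mul_of_eq_zero {f : ℂ → ℂ} (hf : AnalyticAt ℂ f 0) (h0 : f 0 = 0) :
    ∃ G, AnalyticAt ℂ G 0 ∧ ∀ᶠ x in 𝓝 0, f x = x * G x := by
  have h1 : ((1 : ℕ) : ℕ∞) ≤ analyticOrderAt f 0 := by
    rw [natCast_le_analyticOrderAt_iff_iteratedDeriv_eq_zero hf]
    intro i hi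
    obtain rfl : i = 0 := by omega
    simpa using h0
  simpa using (natCast_le_analyticOrderAt hf).1 h1

section Local

variable {p R b : ℂ → ℂ} {g : ℕ}

theorem deriv_of_eventuallyEq_div_pow (hR : AnalyticAt ℂ R 0)
    (hp : ∀ᶠ x in 𝓝[≠] 0, p x = R x / x ^ g) :
    ∀ᶠ x in 𝓝[≠] 0, deriv p x = deriv R x / x ^ g - g * R x / x ^ (g + 1) := by
  filter_upwards [EventuallyEq.nhdsNE_deriv hp,
    hR.eventually_analyticAt.filter_mono nhdsWithin_le_nhds, self_mem_nhdsWithin] with x h1 h2 hx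
  rw [h1]
  have := h2.differentiableAt.hasDerivAt.mul (hasDerivAt_pow_inv g hx)
  refine (this.congr_deriv ?_).deriv
  ring

theorem deriv_deriv_of_eventuallyEq_div_pow (hR : AnalyticAt ℂ R 0)
    (hp : ∀ᶠ x in 𝓝[≠] 0, p x = R x / x ^ g) :
    ∀ᶠ x in 𝓝[≠] 0, deriv (deriv p) x = deriv (deriv R) x / x ^ g
      - 2 * g * deriv R x / x ^ (g + 1) + g * (g + 1) * R x / x ^ (g + 2) := by
  filter_upwards [EventuallyEq.nhdsNE_deriv (deriv_of_eventuallyEq_div_pow hR hp),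
    hR.eventually_analyticAt.filter_mono nhdsWithin_le_nhds, self_mem_nhdsWithin] with x h1 h2 hx
  rw [h1]
  have := (h2.deriv.differentiableAt.hasDerivAt.mul (hasDerivAt_pow_inv g hx)).sub
    ((h2.differentiableAt.hasDerivAt.const_mul (g : ℂ)).mul (hasDerivAt_pow_inv (g + 1) hx))
  refine (this.congr_deriv ?_).deriv
  push_cast
  ring

theorem deriv_zero_of_odd_part (hR : AnalyticAt ℂ R 0) (hb : AnalyticAt ℂ b 0)
    (h : ∀ᶠ x in 𝓝 0, R x - R (-x) = x ^ (2 * g + 1) * b x) (hg : g ≠ 0) : deriv R 0 = 0 := by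
  have d1 : HasDerivAt (fun x ↦ R x - R (-x)) (deriv R 0 + deriv R 0) 0 := by
    have e := hR.differentiableAt.hasDerivAt
    have e' : HasDerivAt R (deriv R 0) (-0) := by simpa using e
    simpa using e.fun_sub (e'.scomp (0 : ℂ) (hasDerivAt_neg 0))
  have d2 := (hasDerivAt_pow (2 * g + 1) (0 : ℂ)).fun_mul hb.differentiableAt.hasDerivAt
  have := d1.unique (d2.congr_of_eventuallyEq h)
  simpa [hg, ← two_mul] using this

theorem removableAt_deriv_deriv_div (hR : AnalyticAt ℂ R 0) (hb : AnalyticAt ℂ b 0)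
    (h : ∀ᶠ x in 𝓝 0, R x - R (-x) = x ^ (2 * g + 1) * b x) (hR0 : R 0 ≠ 0)
    (hp : ∀ᶠ x in 𝓝[≠] 0, p x = R x / x ^ g) :
    RemovableAt (fun x ↦ deriv (deriv p) x / p x - g * (g + 1) / x ^ 2) 0 := by
  obtain ⟨G, hG, hRG⟩ : ∃ G, AnalyticAt ℂ G 0 ∧ ∀ᶠ x in 𝓝 0, g * deriv R x = x * G x := by
    apply exists_eq_mul_of_eq_zero (analyticAt_const.fun_mul hR.deriv)
    by_cases hg : g = 0
    · simp [hg]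
    · simp [deriv_zero_of_odd_part hR hb h hg]
  refine ⟨fun x ↦ (deriv (deriv R) x - 2 * G x) / R x, ?_, ?_⟩
  · exact (hR.deriv.deriv.fun_sub (analyticAt_const.fun_mul hG)).fun_div hR hR0
  filter_upwards [hp, deriv_deriv_of_eventuallyEq_div_pow hR hp, self_mem_nhdsWithin,
    hRG.filter_mono nhdsWithin_le_nhds,
    (hR.continuousAt.eventually_ne hR0).filter_mono nhdsWithin_le_nhds] with x h1 h2 hx h3 h4
  have hx : x ≠ 0 := hx
  have hxg : x ^ g ≠ 0 := pow_ne_zero g hx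
  rw [h1, h2, pow_succ, pow_add x g 2]
  set X := x ^ g
  field_simp
  linear_combination (-2 * x) * h3

theorem removableAt_wronskian (hR : AnalyticAt ℂ R 0) (hb : AnalyticAt ℂ b 0)
    (h : ∀ᶠ x in 𝓝 0, R x - R (-x) = x ^ (2 * g + 1) * b x)
    (hp : ∀ᶠ x in 𝓝[≠] 0, p x = R x / x ^ g) :
    RemovableAt (fun x ↦ p (-x) * deriv p x + p x * deriv p (-x)) 0 := by
  refine ⟨fun x ↦ (-1) ^ g * (R x * ((2 * g + 1) * b x + x * deriv b x) - x * b x * deriv R x),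
    ?_, ?_⟩
  · have := hR.deriv
    have := hb.deriv
    fun_prop
  have neg {q : ℂ → Prop} (hq : ∀ᶠ x in 𝓝[≠] (0 : ℂ), q x) : ∀ᶠ x in 𝓝[≠] (0 : ℂ), q (-x) :=
    eventually_nhdsNE_neg.2 (by simpa using hq)
  have hRan : ∀ᶠ x in 𝓝[≠] (0 : ℂ), AnalyticAt ℂ R x :=
    hR.eventually_analyticAt.filter_mono nhdsWithin_le_nhds
  have hbn : ∀ᶠ x in 𝓝[≠] (0 : ℂ), AnalyticAt ℂ b x :=
    hb.eventually_analyticAt.filter_mono nhdsWithin_le_nhds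
  filter_upwards [hp, neg hp, deriv_of_eventuallyEq_div_pow hR hp,
    neg (deriv_of_eventuallyEq_div_pow hR hp), self_mem_nhdsWithin,
    hRan, neg hRan, hbn, h.eventually_nhds.filter_mono nhdsWithin_le_nhds]
    with x h1 h2 h3 h4 hx h5 h6 h7 h8
  have hx : x ≠ 0 := hx
  have d1 : HasDerivAt (fun x ↦ R x - R (-x)) (deriv R x + deriv R (-x)) x := by
    simpa using h5.differentiableAt.hasDerivAt.fun_sub
      (h6.differentiableAt.hasDerivAt.scomp x (hasDerivAt_neg x))
  have d2 := (hasDerivAt_pow (2 * g + 1) x).fun_mul h7.differentiableAt.hasDerivAt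
  have e := d1.unique (d2.congr_of_eventuallyEq h8)
  have e0 := h8.self_of_nhds
  push_cast [Nat.add_sub_cancel] at e
  rw [h1, h2, h3, h4, neg_pow x g, neg_pow x (g + 1)]
  have hs : ((-1 : ℂ) ^ g) ^ 2 = 1 := by rw [← pow_mul, mul_comm, pow_mul]; simp
  have hs0 : ((-1 : ℂ) ^ g) ≠ 0 := by simp
  have e1 : deriv R (-x) = (2 * g + 1) * x ^ (2 * g) * b x + x ^ (2 * g + 1) * deriv b x
      - deriv R x := by linear_combination e
  have e2 : R (-x) = R x - x ^ (2 * g + 1) * b x := by linear_combination -e0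
  rw [e1, e2, pow_succ (-1 : ℂ) g]
  set s : ℂ := (-1) ^ g
  field_simp
  rw [hs]
  ring

theorem removableAt_deriv_deriv_div_of_simple_zero (hR : AnalyticAt ℂ R 0) (h0 : R 0 = 0)
    (h1 : deriv R 0 ≠ 0)
    (h : ∀ᶠ x in 𝓝[≠] 0, R (-x) * deriv (deriv R) x = R x * deriv (deriv R) (-x)) :
    RemovableAt (fun x ↦ deriv (deriv R) x / R x) 0 := by
  obtain ⟨q, hq, hRq⟩ := exists_eq_mul_of_eq_zero hR h0
  have hq0 : q 0 ≠ 0 := by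
    have := ((hasDerivAt_id (0 : ℂ)).fun_mul hq.differentiableAt.hasDerivAt).congr_of_eventuallyEq
      hRq
    rw [this.deriv] at h1
    simpa using h1
  have hRq' : ∀ᶠ x in 𝓝 (0 : ℂ), R (-x) = -x * q (-x) :=
    (continuous_neg.tendsto' (0 : ℂ) 0 (by simp)).eventually hRq
  have h2 : deriv (deriv R) 0 = 0 := by
    have hRR := hR.deriv.deriv
    have e : (fun x ↦ q (-x) * deriv (deriv R) x) =ᶠ[𝓝[≠] 0]
        fun x ↦ -(q x * deriv (deriv R) (-x)) := by
      filter_upwards [h, hRq.filter_mono nhdsWithin_le_nhds,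
        hRq'.filter_mono nhdsWithin_le_nhds, self_mem_nhdsWithin] with x e1 e2 e3 hx
      rw [e2, e3] at e1
      apply mul_left_cancel₀ (show x ≠ 0 from hx)
      linear_combination -e1
    have c1 : ContinuousAt (fun x ↦ q (-x) * deriv (deriv R) x) 0 :=
      (hq.continuousAt.comp_of_eq continuousAt_neg (by simp)).mul hRR.continuousAt
    have c2 : ContinuousAt (fun x ↦ -(q x * deriv (deriv R) (-x))) 0 :=
      (hq.continuousAt.mul (hRR.continuousAt.comp_of_eq continuousAt_neg (by simp))).neg
    have := ((c1.eventuallyEq_nhds_iff_eventuallyEq_nhdsNE c2).1 e).eq_of_nhds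
    simp only [neg_zero, eq_neg_iff_add_eq_zero, ← two_mul] at this
    simpa [hq0] using this
  obtain ⟨r, hr, hRr⟩ := exists_eq_mul_of_eq_zero hR.deriv.deriv h2
  refine ⟨fun x ↦ r x / q x, hr.fun_div hq hq0, ?_⟩
  filter_upwards [hRr.filter_mono nhdsWithin_le_nhds, hRq.filter_mono nhdsWithin_le_nhds,
    self_mem_nhdsWithin] with x e1 e2 hx
  rw [e1, e2, mul_div_mul_left _ _ hx]

end Local

section Core

variable {L : PeriodPair} {ω : Fin 4 → ℂ}

theorem mem_lattice_of_half_period (hω : ω = ![0, L.ω₁, L.ω₂, -L.ω₁ - L.ω₂]) (s : Fin 4) :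
    ω s ∈ L.lattice := by
  have h1 := L.ω₁_mem_lattice
  have h2 := L.ω₂_mem_lattice
  subst hω
  fin_cases s
  · exact zero_mem _
  · exact h1
  · exact h2
  · exact sub_mem (neg_mem h1) h2

theorem exists_eq_half_period_add (hω : ω = ![0, L.ω₁, L.ω₂, -L.ω₁ - L.ω₂]) {a : ℂ}
    (ha : a ∈ L.lattice) :
    ∃ (s : Fin 4) (m n : ℤ), a = ω s + m * (2 * L.ω₁) + n * (2 * L.ω₂) := by
  obtain ⟨m, n, rfl⟩ := PeriodPair.mem_lattice.1 ha
  subst hω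
  obtain ⟨m, rfl | rfl⟩ := Int.even_or_odd' m <;> obtain ⟨n, rfl | rfl⟩ := Int.even_or_odd' n
  · exact ⟨0, m, n, by simp; ring⟩
  · exact ⟨2, m, n, by simp; ring⟩
  · exact ⟨1, m, n, by simp; ring⟩
  · exact ⟨3, m + 1, n + 1, by simp; ring⟩

theorem eventually_notMem_lattice (L : PeriodPair) (a : ℂ) : ∀ᶠ z in 𝓝[≠] a, z ∉ L.lattice := by
  filter_upwards [mem_nhdsWithin_of_mem_nhds (L.compl_lattice_sdiff_singleton_mem_nhds a),
    self_mem_nhdsWithin] with z h1 h2 h3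
  exact h1 ⟨h3, h2⟩

theorem exists_eventually_eq_const_of_half_periods (hω : ω = ![0, L.ω₁, L.ω₂, -L.ω₁ - L.ω₂])
    {F : ℂ → ℂ} (hF : ∀ a ∉ L.lattice, RemovableAt F a) (hF' : ∀ s, RemovableAt F (ω s))
    (hper : ∀ s, ∀ a, ∀ᶠ z in 𝓝[≠] a, F (z + 2 * ω s) = F z) :
    ∃ c, ∀ a, ∀ᶠ z in 𝓝[≠] a, F z = c := by
  have h1 : ∀ a, ∀ᶠ z in 𝓝[≠] a, F (z + 2 * L.ω₁) = F z := by simpa [hω] using hper 1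
  have h2 : ∀ a, ∀ᶠ z in 𝓝[≠] a, F (z + 2 * L.ω₂) = F z := by simpa [hω] using hper 2
  refine exists_eventually_eq_const_of_removable L (fun a ↦ ?_) h1 h2
  by_cases ha : a ∈ L.lattice
  · obtain ⟨s, m, n, rfl⟩ := exists_eq_half_period_add hω ha
    rw [(removableAt_periodic h2).int_mul n, (removableAt_periodic h1).int_mul m]
    exact hF' s
  · exact hF a ha

variable {φ u : ℂ → ℂ} {g : Fin 4 → ℕ}

theorem deriv_add_of_quasiperiodic {c μ : ℂ} (h : ∀ z, φ (z + c) = μ * φ z) (z : ℂ) :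
    deriv φ (z + c) = μ * deriv φ z := by
  rw [← deriv_comp_add_const, ← deriv_const_mul_field]
  simp only [h]

theorem deriv_deriv_comp_const_add (f : ℂ → ℂ) (c x : ℂ) :
    deriv (deriv fun y ↦ f (c + y)) x = deriv (deriv f) (c + x) := by
  rw [← deriv_comp_const_add]
  congr 1
  ext y
  rw [deriv_comp_const_add]

/-- The Wronskian of `φ` and `z ↦ φ (-z)` is constant. -/
theorem exists_wronskian_eq_const (hω : ω = ![0, L.ω₁, L.ω₂, -L.ω₁ - L.ω₂])
    (hper : ∀ s, ∃ μ : ℂ, μ ≠ 0 ∧ ∀ z, φ (z + 2 * ω s) = μ * φ z)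
    (han : ∀ z ∉ L.lattice, AnalyticAt ℂ φ z)
    (hloc : ∀ s, ∃ R b, AnalyticAt ℂ R 0 ∧ AnalyticAt ℂ b 0 ∧
      (∀ᶠ x in 𝓝 0, R x - R (-x) = x ^ (2 * g s + 1) * b x) ∧
      ∀ᶠ x in 𝓝[≠] 0, φ (ω s + x) = R x / x ^ g s) :
    ∃ c, ∀ a, ∀ᶠ z in 𝓝[≠] a, φ (-z) * deriv φ z + φ z * deriv φ (-z) = c := by
  refine exists_eventually_eq_const_of_half_periods hω (fun a ha ↦ ?_) (fun s ↦ ?_) fun s a ↦ ?_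
  · apply AnalyticAt.removableAt
    have h1 := han a ha
    have h2 := han (-a) (by simpa using ha)
    have h3 : AnalyticAt ℂ (fun z ↦ φ (-z)) a := h2.fun_comp (f := fun z ↦ -z) (by fun_prop)
    have h4 : AnalyticAt ℂ (fun z ↦ deriv φ (-z)) a :=
      h2.deriv.fun_comp (f := fun z ↦ -z) (by fun_prop)
    exact (h3.fun_mul h1.deriv).fun_add (h1.fun_mul h4)
  · obtain ⟨μ, hμ, h⟩ := hper s
    obtain ⟨R, b, hR, hb, hRb, hφ⟩ := hloc s
    rw [← removableAt_comp_const_add_zero]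
    refine ((removableAt_wronskian hR hb hRb hφ).const_mul μ⁻¹).congr (Eventually.of_forall ?_)
    intro x
    have e1 : φ (ω s + -x) = μ * φ (-(ω s + x)) := by rw [← h]; ring_nf
    have e2 : deriv φ (ω s + -x) = μ * deriv φ (-(ω s + x)) := by
      rw [← deriv_add_of_quasiperiodic h]; ring_nf
    simp only [deriv_comp_const_add, e1, e2]
    field_simp
  · obtain ⟨μ, hμ, h⟩ := hper s
    refine Eventually.of_forall fun z ↦ ?_
    have e1 : φ (-z) = μ * φ (-(z + 2 * ω s)) := by rw [← h]; ring_nf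
    have e2 : deriv φ (-z) = μ * deriv φ (-(z + 2 * ω s)) := by
      rw [← deriv_add_of_quasiperiodic h]; ring_nf
    rw [h, deriv_add_of_quasiperiodic h, e1, e2]
    ring

theorem mul_deriv_deriv_neg_eq (han : ∀ z ∉ L.lattice, AnalyticAt ℂ φ z) {c : ℂ}
    (hc : ∀ a, ∀ᶠ z in 𝓝[≠] a, φ (-z) * deriv φ z + φ z * deriv φ (-z) = c)
    {z : ℂ} (hz : z ∉ L.lattice) :
    φ (-z) * deriv (deriv φ) z = φ z * deriv (deriv φ) (-z) := by
  have h1 := (han z hz).differentiableAt.hasDerivAt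
  have h1' := (han z hz).deriv.differentiableAt.hasDerivAt
  have hn := han (-z) (by simpa using hz)
  have h2 := hn.differentiableAt.hasDerivAt.scomp z (hasDerivAt_neg z)
  have h2' := hn.deriv.differentiableAt.hasDerivAt.scomp z (hasDerivAt_neg z)
  have h3 := (h2.fun_mul h1').fun_add (h1.fun_mul h2')
  have h4 : (fun z ↦ φ (-z) * deriv φ z + φ z * deriv φ (-z)) =ᶠ[𝓝 z] fun _ ↦ c :=
    (h3.continuousAt.eventuallyEq_nhds_iff_eventuallyEq_nhdsNE continuousAt_const).1 (hc z)
  have h5 := h3.unique ((hasDerivAt_const z c).congr_of_eventuallyEq h4)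
  simp only [Function.comp_apply, neg_smul, one_smul] at h5
  linear_combination h5

/-- A quasi-periodic function whose odd part at the half-periods vanishes to high order is an
eigenfunction of the Schrödinger operator whose potential has the matching double poles. -/
theorem exists_schrodinger_eigenvalue (hω : ω = ![0, L.ω₁, L.ω₂, -L.ω₁ - L.ω₂])
    (hper : ∀ s, ∃ μ : ℂ, μ ≠ 0 ∧ ∀ z, φ (z + 2 * ω s) = μ * φ z)
    (han : ∀ z ∉ L.lattice, AnalyticAt ℂ φ z)
    (hloc : ∀ s, ∃ R b, AnalyticAt ℂ R 0 ∧ AnalyticAt ℂ b 0 ∧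
      (∀ᶠ x in 𝓝 0, R x - R (-x) = x ^ (2 * g s + 1) * b x) ∧
      (∀ᶠ x in 𝓝[≠] 0, φ (ω s + x) = R x / x ^ g s) ∧
      (R 0 ≠ 0 ∨ g s = 0 ∧ R 0 = 0 ∧ deriv R 0 ≠ 0))
    (hzero : ∀ z ∉ L.lattice, φ z = 0 → φ (-z) ≠ 0)
    (hne : ∀ a, ∀ᶠ z in 𝓝[≠] a, φ z ≠ 0)
    (huan : ∀ z ∉ L.lattice, AnalyticAt ℂ u z)
    (huper : ∀ s, ∀ z ∉ L.lattice, u (z + 2 * ω s) = u z)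
    (huloc : ∀ s, RemovableAt (fun x ↦ u (ω s + x) - g s * (g s + 1) / x ^ 2) 0) :
    ∃ ε : ℂ, ∀ a, ∀ᶠ z in 𝓝[≠] a, -deriv (deriv φ) z + u z * φ z = ε * φ z := by
  obtain ⟨c, hc⟩ := exists_wronskian_eq_const hω hper han (g := g) fun s ↦ by
    obtain ⟨R, b, h1, h2, h3, h4, -⟩ := hloc s
    exact ⟨R, b, h1, h2, h3, h4⟩
  have hW {z : ℂ} (hz : z ∉ L.lattice) := mul_deriv_deriv_neg_eq han hc hz
  suffices ∃ ε, ∀ a, ∀ᶠ z in 𝓝[≠] a, deriv (deriv φ) z / φ z - u z = ε by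
    obtain ⟨ε, hε⟩ := this
    refine ⟨-ε, fun a ↦ ?_⟩
    filter_upwards [hε a, hne a] with z h1 h2
    rw [← h1]
    field_simp
    ring
  refine exists_eventually_eq_const_of_half_periods hω (fun a ha ↦ ?_) (fun s ↦ ?_) fun s a ↦ ?_
  · refine RemovableAt.sub ?_ (huan a ha).removableAt
    have hna : -a ∉ L.lattice := by simpa using ha
    by_cases h0 : φ a = 0
    · refine ⟨fun z ↦ deriv (deriv φ) (-z) / φ (-z), ?_, ?_⟩
      · exact ((han _ hna).deriv.deriv.fun_div (han _ hna) (hzero a ha h0)).fun_comp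
          (f := fun z ↦ -z) (by fun_prop)
      · have hcont : ContinuousAt (fun z ↦ φ (-z)) a :=
          (han _ hna).continuousAt.comp_of_eq continuousAt_neg rfl
        filter_upwards [eventually_notMem_lattice L a, hne a,
          (hcont.eventually_ne (hzero a ha h0)).filter_mono nhdsWithin_le_nhds] with z h1 h2 h3
        rw [div_eq_div_iff h2 h3]
        linear_combination hW h1
    · exact ((han a ha).deriv.deriv.fun_div (han a ha) h0).removableAt
  · obtain ⟨R, b, hR, hb, hRb, hφ, hR0⟩ := hloc s
    obtain ⟨μ, hμ, h⟩ := hper s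
    rw [← removableAt_comp_const_add_zero]
    have key : RemovableAt (fun x ↦ deriv (deriv fun y ↦ φ (ω s + y)) x / φ (ω s + x)
        - g s * (g s + 1) / x ^ 2) 0 := by
      rcases hR0 with hR0 | ⟨hg, hR0, hR1⟩
      · exact removableAt_deriv_deriv_div hR hb hRb hR0 hφ
      · simp only [hg, pow_zero, div_one, Nat.cast_zero, zero_mul, zero_div, sub_zero] at hφ ⊢
        replace hφ : (fun x ↦ φ (ω s + x)) =ᶠ[𝓝[≠] 0] R := hφ
        have hd := hφ.nhdsNE_deriv.nhdsNE_deriv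
        have neg {q : ℂ → Prop} (hq : ∀ᶠ x in 𝓝[≠] (0 : ℂ), q x) :
            ∀ᶠ x in 𝓝[≠] (0 : ℂ), q (-x) := eventually_nhdsNE_neg.2 (by simpa using hq)
        refine (removableAt_deriv_deriv_div_of_simple_zero hR hR0 hR1 ?_).congr (hd.div hφ)
        have hnl := (eventually_nhdsNE_add_left (c := ω s) (a := 0)).2
          (eventually_notMem_lattice L (ω s + 0))
        filter_upwards [hφ, neg hφ, hd, neg hd, hnl] with x h1 h2 h3 h4 h5
        have e1 : φ (ω s + -x) = μ * φ (-(ω s + x)) := by rw [← h]; ring_nf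
        have e2 : deriv (deriv φ) (ω s + -x) = μ * deriv (deriv φ) (-(ω s + x)) := by
          rw [← deriv_add_of_quasiperiodic (deriv_add_of_quasiperiodic h)]; ring_nf
        rw [← h1, ← h2, ← h3, ← h4, deriv_deriv_comp_const_add, deriv_deriv_comp_const_add, e1, e2]
        linear_combination μ * hW h5
    refine (key.sub (huloc s)).congr (Eventually.of_forall fun x ↦ ?_)
    simp only [deriv_deriv_comp_const_add]
    ring
  · obtain ⟨μ, hμ, h⟩ := hper s
    filter_upwards [eventually_notMem_lattice L a] with z hz
    rw [h, deriv_add_of_quasiperiodic (deriv_add_of_quasiperiodic h), huper s z hz,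
      mul_div_mul_left _ _ hμ]

end Core

/-- `f` is quasi-periodic with period `c` and multiplier proportional to `exp (h * z)`. -/
def HasMultiplier (f : ℂ → ℂ) (c h : ℂ) : Prop :=
  ∃ κ : ℂ, κ ≠ 0 ∧ ∀ z, f (z + c) = κ * Complex.exp (h * z) * f z

namespace HasMultiplier

variable {f f' : ℂ → ℂ} {c c' h h' : ℂ}

theorem mul (hf : HasMultiplier f c h) (hf' : HasMultiplier f' c h') :
    HasMultiplier (fun z ↦ f z * f' z) c (h + h') := by
  obtain ⟨κ, hκ, e⟩ := hf
  obtain ⟨κ', hκ', e'⟩ := hf'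
  refine ⟨κ * κ', mul_ne_zero hκ hκ', fun z ↦ ?_⟩
  beta_reduce
  rw [e, e', add_mul, Complex.exp_add]
  ring

theorem const (a : ℂ) : HasMultiplier (fun _ ↦ a) c 0 := ⟨1, one_ne_zero, by simp⟩

theorem exp (k : ℂ) : HasMultiplier (fun z ↦ Complex.exp (k * z)) c 0 := by
  refine ⟨Complex.exp (k * c), Complex.exp_ne_zero _, fun z ↦ ?_⟩
  beta_reduce
  rw [mul_add, Complex.exp_add]
  simp [mul_comm]

theorem prod {ι : Type*} (s : Finset ι) {f : ι → ℂ → ℂ} {h : ι → ℂ}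
    (H : ∀ i ∈ s, HasMultiplier (f i) c (h i)) :
    HasMultiplier (fun z ↦ ∏ i ∈ s, f i z) c (∑ i ∈ s, h i) := by
  classical
  induction s using Finset.induction_on with
  | empty => simpa using const 1
  | insert i s hi ih =>
    simp only [Finset.prod_insert hi, Finset.sum_insert hi]
    exact (H i (by simp)).mul (ih fun j hj ↦ H j (by simp [hj]))

theorem pow (hf : HasMultiplier f c h) (n : ℕ) :
    HasMultiplier (fun z ↦ f z ^ n) c (n * h) := by
  simpa using prod (Finset.range n) (f := fun _ ↦ f) (h := fun _ ↦ h) fun _ _ ↦ hf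

theorem comp_add_const (hf : HasMultiplier f c h) (a : ℂ) :
    HasMultiplier (fun z ↦ f (z + a)) c h := by
  obtain ⟨κ, hκ, e⟩ := hf
  refine ⟨κ * Complex.exp (h * a), mul_ne_zero hκ (Complex.exp_ne_zero _), fun z ↦ ?_⟩
  beta_reduce
  rw [add_right_comm, e, mul_add, Complex.exp_add]
  ring

theorem add_period (hf : HasMultiplier f c h) (hf' : HasMultiplier f c' h') :
    HasMultiplier f (c + c') (h + h') := by
  obtain ⟨κ, hκ, e⟩ := hf
  obtain ⟨κ', hκ', e'⟩ := hf'
  refine ⟨κ * κ' * Complex.exp (h' * c),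
    mul_ne_zero (mul_ne_zero hκ hκ') (Complex.exp_ne_zero _), fun z ↦ ?_⟩
  rw [← add_assoc, e', e, mul_add, add_mul, Complex.exp_add, Complex.exp_add]
  ring

theorem neg_period (hf : HasMultiplier f c h) : HasMultiplier f (-c) (-h) := by
  obtain ⟨κ, hκ, e⟩ := hf
  refine ⟨κ⁻¹ * Complex.exp (h * c), mul_ne_zero (inv_ne_zero hκ) (Complex.exp_ne_zero _),
    fun z ↦ ?_⟩
  have := e (z + -c)
  rw [neg_add_cancel_right] at this
  rw [this, mul_add, Complex.exp_add, mul_neg, neg_mul, Complex.exp_neg, Complex.exp_neg]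
  field_simp [Complex.exp_ne_zero]

theorem div (hf : HasMultiplier f c h) (hf' : HasMultiplier f' c h) :
    ∃ μ : ℂ, μ ≠ 0 ∧ ∀ z, f (z + c) / f' (z + c) = μ * (f z / f' z) := by
  obtain ⟨κ, hκ, e⟩ := hf
  obtain ⟨κ', hκ', e'⟩ := hf'
  refine ⟨κ / κ', div_ne_zero hκ hκ', fun z ↦ ?_⟩
  rw [e, e', mul_right_comm κ, mul_right_comm κ', mul_div_mul_right _ _ (Complex.exp_ne_zero _),
    mul_div_mul_comm]

end HasMultiplier

/-- The properties of the Weierstrass sigma function that do not involve the normalization of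
the quasi-periods `η`. -/
structure IsSigma (L : PeriodPair) (ω η : Fin 4 → ℂ) (σ : ℂ → ℂ) : Prop where
  differentiable : Differentiable ℂ σ
  neg : ∀ z, σ (-z) = -σ z
  eq_zero_iff : ∀ z, σ z = 0 ↔ ∃ l ∈ L.lattice, z = 2 * l
  deriv_ne_zero : ∀ z, σ z = 0 → deriv σ z ≠ 0
  hasMultiplier : ∀ s, HasMultiplier σ (2 * ω s) (2 * η s)

section Parity

variable {f w : ℂ → ℂ} {c : ℂ} {g : ℕ}

theorem exists_odd_part_eq_pow_mul (hf : Differentiable ℂ f)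
    (h : ∀ j, 1 ≤ j → j ≤ g → iteratedDeriv (2 * j - 1) f c = 0) :
    ∃ b, AnalyticAt ℂ b 0 ∧ ∀ᶠ x in 𝓝 0, f (c + x) - f (c + -x) = x ^ (2 * g + 1) * b x := by
  have hd : Differentiable ℂ fun x ↦ f (c + x) := by fun_prop
  have hd' : Differentiable ℂ fun x ↦ f (c + -x) := by fun_prop
  have han : AnalyticAt ℂ (fun x ↦ f (c + x) - f (c + -x)) 0 := (hd.sub hd').analyticAt 0
  have := (natCast_le_analyticOrderAt_iff_iteratedDeriv_eq_zero (n := 2 * g + 1) han).2 ?_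
  · simpa using (natCast_le_analyticOrderAt han).1 this
  intro i hi
  rw [iteratedDeriv_fun_sub hd.contDiff.contDiffAt hd'.contDiff.contDiffAt,
    iteratedDeriv_comp_neg i (fun x ↦ f (c + x)), iteratedDeriv_comp_const_add]
  rcases Nat.even_or_odd' i with ⟨j, rfl | rfl⟩
  · simp
  · have := h (j + 1) (by omega) (by omega)
    rw [show 2 * (j + 1) - 1 = 2 * j + 1 by omega] at this
    simp [this]

theorem eventually_even_of_pow_mul {E : ℂ → ℂ} {κ : ℂ} (hE : AnalyticAt ℂ E 0) (hE0 : E 0 ≠ 0)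
    (hw : ∀ᶠ x in 𝓝 0, w x = x ^ g * E x) (hκ : ∀ x, w (-x) = κ * w x) :
    ∀ᶠ x in 𝓝 0, E (-x) = E x := by
  have hw' : ∀ᶠ x in 𝓝 (0 : ℂ), w (-x) = (-x) ^ g * E (-x) :=
    (continuous_neg.tendsto' (0 : ℂ) 0 (by simp)).eventually hw
  have hEn : ContinuousAt (fun x ↦ E (-x)) 0 :=
    hE.continuousAt.comp_of_eq continuousAt_neg (by simp)
  have e : (fun x ↦ κ * E x) =ᶠ[𝓝 0] fun x ↦ (-1) ^ g * E (-x) := by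
    refine ((hE.continuousAt.const_mul κ).eventuallyEq_nhds_iff_eventuallyEq_nhdsNE
      (hEn.const_mul _)).1 ?_
    filter_upwards [hw.filter_mono nhdsWithin_le_nhds, hw'.filter_mono nhdsWithin_le_nhds,
      self_mem_nhdsWithin] with x h1 h2 hx
    apply mul_left_cancel₀ (pow_ne_zero g (show x ≠ 0 from hx))
    have := hκ x
    rw [h1, h2, neg_pow] at this
    linear_combination -this
  have hκ' : κ = (-1) ^ g := by
    have := e.eq_of_nhds
    simpa [hE0] using this
  filter_upwards [e] with x hx
  rw [hκ'] at hx
  exact (mul_left_cancel₀ (by simp) hx).symm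

end Parity

namespace IsSigma

variable {L : PeriodPair} {ω η : Fin 4 → ℂ} {σ P : ℂ → ℂ} {σS : Fin 4 → ℂ → ℂ}

theorem apply_ne_zero_of_notMem (hσ : IsSigma L ω η σ) {z : ℂ} (hz : z ∉ L.lattice)
    {p : ℂ} (hp : p ∈ L.lattice) : σ (z + p) ≠ 0 := by
  rw [Ne, hσ.eq_zero_iff]
  rintro ⟨l, hl, h⟩
  apply hz
  have := sub_mem (add_mem hl hl) hp
  rwa [← two_mul, ← h, add_sub_cancel_right] at this

theorem apply_half_period_add_eq_zero_iff (hσ : IsSigma L ω η σ)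
    (hω : ω = ![0, L.ω₁, L.ω₂, -L.ω₁ - L.ω₂]) {s p : Fin 4} :
    σ (ω s + ω p) = 0 ↔ p = s := by
  rw [hσ.eq_zero_iff]
  constructor
  · rintro ⟨l, hl, h⟩
    obtain ⟨m, n, rfl⟩ := PeriodPair.mem_lattice.1 hl
    have hli := LinearIndependent.pair_iff.1 L.indep
    have key (a b : ℤ) (h : a * L.ω₁ + b * L.ω₂ = 2 * (m * L.ω₁ + n * L.ω₂)) :
        a = 2 * m ∧ b = 2 * n := by
      have := hli (a - 2 * m) (b - 2 * n) (by
        simp only [Complex.real_smul]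
        push_cast
        linear_combination h)
      exact ⟨by exact_mod_cast sub_eq_zero.1 this.1, by exact_mod_cast sub_eq_zero.1 this.2⟩
    let A : Fin 4 → ℤ := ![0, 1, 0, -1]
    let B : Fin 4 → ℤ := ![0, 0, 1, -1]
    have hAB (s : Fin 4) : ω s = A s * L.ω₁ + B s * L.ω₂ := by
      subst hω
      fin_cases s <;> simp [A, B]
      ring
    have := key (A s + A p) (B s + B p) (by
      rw [← h, hAB s, hAB p]
      push_cast
      ring)
    clear hAB
    fin_cases s <;> fin_cases p <;> simp [A, B] at this ⊢ <;> omega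
  · rintro rfl
    exact ⟨ω p, mem_lattice_of_half_period hω p, by ring⟩

theorem eventually_ne_zero (hσ : IsSigma L ω η σ) (a : ℂ) : ∀ᶠ z in 𝓝[≠] a, σ z ≠ 0 := by
  by_cases h : σ a = 0
  · exact (hσ.differentiable a).hasDerivAt.eventually_ne (hσ.deriv_ne_zero a h)
  · exact (hσ.differentiable.continuous.continuousAt.eventually_ne h).filter_mono
      nhdsWithin_le_nhds

theorem deriv_div_analyticAt (hσ : IsSigma L ω η σ) {z : ℂ} (hz : σ z ≠ 0) :
    AnalyticAt ℂ (fun u ↦ deriv σ u / σ u) z :=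
  (hσ.differentiable.analyticAt z).deriv.fun_div (hσ.differentiable.analyticAt z) hz

theorem analyticAt_P (hσ : IsSigma L ω η σ)
    (hP : ∀ z, P z = -deriv (fun u ↦ deriv σ u / σ u) z) {z : ℂ} (hz : σ z ≠ 0) :
    AnalyticAt ℂ P z := by
  rw [funext hP]
  exact (hσ.deriv_div_analyticAt hz).deriv.fun_neg

theorem P_add_two_mul (hσ : IsSigma L ω η σ)
    (hP : ∀ z, P z = -deriv (fun u ↦ deriv σ u / σ u) z) (s : Fin 4) {z : ℂ} (hz : σ z ≠ 0) :
    P (z + 2 * ω s) = P z := by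
  obtain ⟨κ, hκ, h⟩ := hσ.hasMultiplier s
  have e : (fun u ↦ deriv σ (u + 2 * ω s) / σ (u + 2 * ω s)) =ᶠ[𝓝 z]
      fun u ↦ deriv σ u / σ u + 2 * η s := by
    filter_upwards [hσ.differentiable.continuous.continuousAt.eventually_ne hz] with u hu
    have d1 := (hσ.differentiable (u + 2 * ω s)).hasDerivAt.comp_add_const u (2 * ω s)
    have d2 := ((((hasDerivAt_id u).const_mul (2 * η s)).cexp.const_mul κ).fun_mul
      (hσ.differentiable u).hasDerivAt)
    have := d1.unique (d2.congr_of_eventuallyEq (Eventually.of_forall h))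
    rw [this, h]
    simp only [id]
    field_simp [Complex.exp_ne_zero]
    ring
  rw [hP, hP, ← deriv_comp_add_const, e.deriv_eq, deriv_add_const]

theorem removableAt_P (hσ : IsSigma L ω η σ)
    (hP : ∀ z, P z = -deriv (fun u ↦ deriv σ u / σ u) z) :
    RemovableAt (fun x ↦ P x - 1 / x ^ 2) 0 := by
  have h0 : σ 0 = 0 := (hσ.eq_zero_iff 0).2 ⟨0, zero_mem _, by simp⟩
  obtain ⟨τ, hτ, e⟩ := exists_eq_mul_of_eq_zero (hσ.differentiable.analyticAt 0) h0
  have hτ0 : τ 0 ≠ 0 := by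
    have := ((hasDerivAt_id (0 : ℂ)).fun_mul hτ.differentiableAt.hasDerivAt).congr_of_eventuallyEq e
    have h1 := hσ.deriv_ne_zero 0 h0
    rw [this.deriv] at h1
    simpa using h1
  have hq : AnalyticAt ℂ (fun x ↦ deriv τ x / τ x) 0 := hτ.deriv.fun_div hτ hτ0
  refine ⟨fun x ↦ -deriv (fun x ↦ deriv τ x / τ x) x, hq.deriv.fun_neg, ?_⟩
  have e1 : (fun x ↦ deriv σ x / σ x) =ᶠ[𝓝[≠] 0] fun x ↦ x⁻¹ + deriv τ x / τ x := by
    filter_upwards [e.eventually_nhds.filter_mono nhdsWithin_le_nhds, self_mem_nhdsWithin,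
      hτ.eventually_analyticAt.filter_mono nhdsWithin_le_nhds,
      (hτ.continuousAt.eventually_ne hτ0).filter_mono nhdsWithin_le_nhds] with x h1 hx h2 h3
    have hx : x ≠ 0 := hx
    have := ((hasDerivAt_id x).fun_mul h2.differentiableAt.hasDerivAt).congr_of_eventuallyEq h1
    rw [this.deriv, h1.self_of_nhds]
    simp only [id]
    field_simp
  filter_upwards [e1.nhdsNE_deriv, self_mem_nhdsWithin,
    hq.eventually_analyticAt.filter_mono nhdsWithin_le_nhds] with x h1 hx h2
  have := (hasDerivAt_inv (show x ≠ 0 from hx)).fun_add h2.differentiableAt.hasDerivAt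
  rw [hP, h1, this.deriv]
  simp

theorem removableAt_potential (hσ : IsSigma L ω η σ) (hω : ω = ![0, L.ω₁, L.ω₂, -L.ω₁ - L.ω₂])
    (hP : ∀ z, P z = -deriv (fun u ↦ deriv σ u / σ u) z) (g : Fin 4 → ℂ) (s : Fin 4) :
    RemovableAt (fun x ↦ ∑ p, g p * P (ω s + x + ω p) - g s / x ^ 2) 0 := by
  have key (p : Fin 4) :
      RemovableAt (fun x ↦ g p * P (ω s + x + ω p) - if p = s then g s / x ^ 2 else 0) 0 := by
    by_cases h : p = s
    · subst h
      simp only [if_true]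
      refine ((hσ.removableAt_P hP).const_mul (g p)).congr ?_
      filter_upwards [hσ.eventually_ne_zero 0] with x hx
      rw [show ω p + x + ω p = x + 2 * ω p by ring, hσ.P_add_two_mul hP p hx]
      ring
    · simp only [if_neg h, sub_zero]
      refine RemovableAt.const_mul _ (AnalyticAt.removableAt ?_)
      refine (hσ.analyticAt_P hP (z := ω s + ω p) ?_).fun_comp_of_eq
        (f := fun x ↦ ω s + x + ω p) (by fun_prop) (by simp)
      rwa [Ne, hσ.apply_half_period_add_eq_zero_iff hω]
  refine (RemovableAt.sum Finset.univ fun p _ ↦ key p).congr (Eventually.of_forall fun x ↦ ?_)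
  simp [Finset.sum_sub_distrib]

theorem shifted_differentiable
    (hS : ∀ p, ∃ c : ℂ, c ≠ 0 ∧ ∀ z, σS p z = c * (Complex.exp (-η p * z) * σ (z + ω p)))
    (hσ : IsSigma L ω η σ) (p : Fin 4) : Differentiable ℂ (σS p) := by
  obtain ⟨c, -, h⟩ := hS p
  rw [funext h]
  have := hσ.differentiable
  fun_prop

theorem shifted_eq_zero_iff
    (hS : ∀ p, ∃ c : ℂ, c ≠ 0 ∧ ∀ z, σS p z = c * (Complex.exp (-η p * z) * σ (z + ω p)))
    (p : Fin 4) (z : ℂ) : σS p z = 0 ↔ σ (z + ω p) = 0 := by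
  obtain ⟨c, hc, h⟩ := hS p
  simp [h, hc, Complex.exp_ne_zero]

theorem shifted_hasMultiplier
    (hS : ∀ p, ∃ c : ℂ, c ≠ 0 ∧ ∀ z, σS p z = c * (Complex.exp (-η p * z) * σ (z + ω p)))
    (hσ : IsSigma L ω η σ) (p s : Fin 4) :
    HasMultiplier (σS p) (2 * ω s) (2 * η s) := by
  obtain ⟨c, -, h⟩ := hS p
  rw [funext h]
  simpa using (HasMultiplier.const c).mul
    ((HasMultiplier.exp (-η p)).mul ((hσ.hasMultiplier s).comp_add_const (ω p)))

theorem exists_shifted_neg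
    (hS : ∀ p, ∃ c : ℂ, c ≠ 0 ∧ ∀ z, σS p z = c * (Complex.exp (-η p * z) * σ (z + ω p)))
    (hσ : IsSigma L ω η σ) (p : Fin 4) :
    ∃ κ, ∀ z, σS p (-z) = κ * σS p z := by
  obtain ⟨c, -, h⟩ := hS p
  obtain ⟨κ, hκ, e⟩ := hσ.hasMultiplier p
  refine ⟨-κ⁻¹ * Complex.exp (2 * η p * ω p), fun z ↦ ?_⟩
  have e1 : σ (z + ω p) = κ * Complex.exp (2 * η p * (z - ω p)) * σ (z - ω p) := by
    rw [← e]; ring_nf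
  have e2 : σ (-z + ω p) = -σ (z - ω p) := by
    rw [← hσ.neg]; ring_nf
  have e3 : Complex.exp (-η p * -z) = Complex.exp (2 * η p * ω p) * Complex.exp (-η p * z) *
      Complex.exp (2 * η p * (z - ω p)) := by
    rw [← Complex.exp_add, ← Complex.exp_add]; ring_nf
  rw [h, h, e1, e2, e3]
  field_simp

theorem exists_shifted_local
    (hS : ∀ p, ∃ c : ℂ, c ≠ 0 ∧ ∀ z, σS p z = c * (Complex.exp (-η p * z) * σ (z + ω p)))
    (hσ : IsSigma L ω η σ) (hω : ω = ![0, L.ω₁, L.ω₂, -L.ω₁ - L.ω₂])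
    (s p : Fin 4) : ∃ T, AnalyticAt ℂ T 0 ∧ T 0 ≠ 0 ∧
      ∀ᶠ x in 𝓝 0, σS p (ω s + x) = (if p = s then x else 1) * T x := by
  have hd := shifted_differentiable hS hσ p
  have hdx : Differentiable ℂ fun x ↦ σS p (ω s + x) := by fun_prop
  by_cases hps : p = s
  · subst hps
    have hz : σ (ω p + ω p) = 0 := (hσ.apply_half_period_add_eq_zero_iff hω).2 rfl
    obtain ⟨T, hT, e⟩ := exists_eq_mul_of_eq_zero (hdx.analyticAt 0)
      (by simpa [shifted_eq_zero_iff hS] using hz)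
    refine ⟨T, hT, fun hT0 ↦ ?_, by simpa using e⟩
    have h1 :=
      ((hasDerivAt_id (0 : ℂ)).fun_mul hT.differentiableAt.hasDerivAt).congr_of_eventuallyEq e
    obtain ⟨c, hc, h⟩ := hS p
    have h2 : HasDerivAt (fun x ↦ c * (Complex.exp (-η p * (ω p + x)) * σ (ω p + x + ω p)))
        (c * (Complex.exp (-η p * (ω p + 0)) * (-η p * 1) * σ (ω p + 0 + ω p) +
          Complex.exp (-η p * (ω p + 0)) * deriv σ (ω p + 0 + ω p))) 0 := by
      refine (HasDerivAt.fun_mul ?_ ?_).const_mul c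
      · exact (((hasDerivAt_id (0 : ℂ)).const_add (ω p)).const_mul (-η p)).cexp
      · exact (((hσ.differentiable _).hasDerivAt).comp_add_const (ω p + 0) (ω p)).comp_const_add
          (ω p) 0
    have h3 := h1.unique (by simpa only [h] using h2)
    simp [hT0, hz, hc, Complex.exp_ne_zero, hσ.deriv_ne_zero] at h3
  · refine ⟨fun x ↦ σS p (ω s + x), hdx.analyticAt 0, ?_, by simp [hps]⟩
    simpa [shifted_eq_zero_iff hS, hσ.apply_half_period_add_eq_zero_iff hω] using hps

theorem exists_weight_local
    (hS : ∀ p, ∃ c : ℂ, c ≠ 0 ∧ ∀ z, σS p z = c * (Complex.exp (-η p * z) * σ (z + ω p)))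
    (hσ : IsSigma L ω η σ) (hω : ω = ![0, L.ω₁, L.ω₂, -L.ω₁ - L.ω₂])
    (g : Fin 4 → ℕ) (s : Fin 4) : ∃ T, AnalyticAt ℂ T 0 ∧ T 0 ≠ 0 ∧
      ∀ᶠ x in 𝓝 0, ∏ p, σS p (ω s + x) ^ g p = x ^ g s * T x := by
  choose T hT hT0 e using exists_shifted_local hS hσ hω s
  refine ⟨fun x ↦ ∏ p, T p x ^ g p, ?_, ?_, ?_⟩
  · exact Finset.analyticAt_fun_prod _ fun p _ ↦ (hT p).fun_pow _
  · exact Finset.prod_ne_zero_iff.2 fun p _ ↦ pow_ne_zero _ (hT0 p)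
  filter_upwards [eventually_all.2 e] with x hx
  simp only [hx, mul_pow, Finset.prod_mul_distrib, ite_pow, one_pow]
  simp

theorem exists_weight_neg
    (hS : ∀ p, ∃ c : ℂ, c ≠ 0 ∧ ∀ z, σS p z = c * (Complex.exp (-η p * z) * σ (z + ω p)))
    (hσ : IsSigma L ω η σ) (g : Fin 4 → ℕ) :
    ∃ κ, ∀ z, ∏ p, σS p (-z) ^ g p = κ * ∏ p, σS p z ^ g p := by
  choose κ h using exists_shifted_neg hS hσ
  exact ⟨∏ p, κ p ^ g p, fun z ↦ by simp [h, mul_pow, Finset.prod_mul_distrib]⟩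

theorem weight_hasMultiplier
    (hS : ∀ p, ∃ c : ℂ, c ≠ 0 ∧ ∀ z, σS p z = c * (Complex.exp (-η p * z) * σ (z + ω p)))
    (hσ : IsSigma L ω η σ) (g : Fin 4 → ℕ) (s : Fin 4) :
    HasMultiplier (fun z ↦ ∏ p, σS p z ^ g p) (2 * ω s) ((∑ p, g p : ℕ) * (2 * η s)) := by
  rw [Nat.cast_sum, Finset.sum_mul]
  exact HasMultiplier.prod _ fun p _ ↦ (shifted_hasMultiplier hS hσ p s).pow (g p)

end IsSigma

section BetheFunction

variable {L : PeriodPair} {ω η : Fin 4 → ℂ} {σ : ℂ → ℂ} {m : ℕ} {k : ℂ} {t : Fin m → ℂ}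
  {ψ : ℂ → ℂ}

theorem bethe_differentiable (hσ : IsSigma L ω η σ)
    (hψ : ∀ z, ψ z = Complex.exp (k * z) * ∏ i, σ (z + t i)) : Differentiable ℂ ψ := by
  rw [funext hψ]
  have := hσ.differentiable
  fun_prop

theorem bethe_eq_zero_iff (hψ : ∀ z, ψ z = Complex.exp (k * z) * ∏ i, σ (z + t i)) (z : ℂ) :
    ψ z = 0 ↔ ∃ i, σ (z + t i) = 0 := by
  simp [hψ, Complex.exp_ne_zero, Finset.prod_eq_zero_iff]

theorem bethe_hasMultiplier (hσ : IsSigma L ω η σ)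
    (hψ : ∀ z, ψ z = Complex.exp (k * z) * ∏ i, σ (z + t i)) (s : Fin 4) :
    HasMultiplier ψ (2 * ω s) (m * (2 * η s)) := by
  rw [funext hψ]
  simpa using (HasMultiplier.exp k).mul (HasMultiplier.prod Finset.univ fun i _ ↦
    (hσ.hasMultiplier s).comp_add_const (t i))

theorem bethe_eventually_ne_zero (hσ : IsSigma L ω η σ)
    (hψ : ∀ z, ψ z = Complex.exp (k * z) * ∏ i, σ (z + t i)) (a : ℂ) :
    ∀ᶠ z in 𝓝[≠] a, ψ z ≠ 0 := by
  have h (i : Fin m) : ∀ᶠ z in 𝓝[≠] a, σ (t i + z) ≠ 0 :=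
    eventually_nhdsNE_add_left.2 (hσ.eventually_ne_zero (t i + a))
  filter_upwards [eventually_all.2 h] with z hz
  rw [Ne, bethe_eq_zero_iff hψ]
  rintro ⟨i, hi⟩
  exact hz i (by rwa [add_comm])

theorem bethe_neg_ne_zero (hσ : IsSigma L ω η σ)
    (hψ : ∀ z, ψ z = Complex.exp (k * z) * ∏ i, σ (z + t i))
    (ht : ∀ i j, i ≠ j → σ (t i + t j) ≠ 0) {z : ℂ} (hz : z ∉ L.lattice) (h : ψ z = 0) :
    ψ (-z) ≠ 0 := by
  intro h'
  obtain ⟨i, hi⟩ := (bethe_eq_zero_iff hψ z).1 h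
  obtain ⟨j, hj⟩ := (bethe_eq_zero_iff hψ (-z)).1 h'
  obtain ⟨l, hl, e⟩ := (hσ.eq_zero_iff _).1 hi
  obtain ⟨l', hl', e'⟩ := (hσ.eq_zero_iff _).1 hj
  obtain rfl : i = j := by
    by_contra hij
    exact ht i j hij ((hσ.eq_zero_iff _).2 ⟨l + l', add_mem hl hl', by linear_combination e + e'⟩)
  apply hz
  rw [show z = l - l' by linear_combination (e - e') / 2]
  exact sub_mem hl hl'

theorem bethe_deriv_ne_zero (hσ : IsSigma L ω η σ)
    (hψ : ∀ z, ψ z = Complex.exp (k * z) * ∏ i, σ (z + t i))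
    (ht : ∀ i j, i ≠ j → σ (t i + t j) ≠ 0) {z : ℂ} (hz : z ∈ L.lattice) (h : ψ z = 0) :
    deriv ψ z ≠ 0 := by
  obtain ⟨i, hi⟩ := (bethe_eq_zero_iff hψ z).1 h
  obtain ⟨l, hl, e⟩ := (hσ.eq_zero_iff _).1 hi
  set r : ℂ → ℂ := fun z ↦ Complex.exp (k * z) * ∏ j ∈ Finset.univ.erase i, σ (z + t j) with hr
  have hrd : Differentiable ℂ r := by
    have := hσ.differentiable
    fun_prop
  have hr0 : r z ≠ 0 := by
    refine mul_ne_zero (Complex.exp_ne_zero _) (Finset.prod_ne_zero_iff.2 fun j hj hj0 ↦ ?_)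
    obtain ⟨l', hl', e'⟩ := (hσ.eq_zero_iff _).1 hj0
    refine ht j i (Finset.ne_of_mem_erase hj) ((hσ.eq_zero_iff _).2
      ⟨l + l' - z, sub_mem (add_mem hl hl') hz, by linear_combination e + e'⟩)
  have hψr : ψ = fun z ↦ σ (z + t i) * r z := by
    ext z
    rw [hψ, ← Finset.mul_prod_erase _ _ (Finset.mem_univ i)]
    ring
  have := ((hσ.differentiable (z + t i)).hasDerivAt.comp_add_const z (t i)).fun_mul
    (hrd z).hasDerivAt
  rw [hψr, this.deriv, hi, zero_mul, add_zero]
  exact mul_ne_zero (hσ.deriv_ne_zero _ hi) hr0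

end BetheFunction

/-- Local structure of `φ = ψ / w` at a half-period. -/
theorem exists_local_form {f v : ℂ → ℂ} {c κ : ℂ} {g : ℕ} (hf : Differentiable ℂ f)
    (hbethe : ∀ j, 1 ≤ j → j ≤ g → iteratedDeriv (2 * j - 1) f c = 0)
    (hf0 : f c = 0 → deriv f c ≠ 0)
    {E : ℂ → ℂ} (hE : AnalyticAt ℂ E 0) (hE0 : E 0 ≠ 0)
    (hv : ∀ᶠ x in 𝓝 0, v (c + x) = x ^ g * E x) (hκ : ∀ x, v (c + -x) = κ * v (c + x)) :
    ∃ R b, AnalyticAt ℂ R 0 ∧ AnalyticAt ℂ b 0 ∧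
      (∀ᶠ x in 𝓝 0, R x - R (-x) = x ^ (2 * g + 1) * b x) ∧
      (∀ᶠ x in 𝓝[≠] 0, f (c + x) / v (c + x) = R x / x ^ g) ∧
      (R 0 ≠ 0 ∨ g = 0 ∧ R 0 = 0 ∧ deriv R 0 ≠ 0) := by
  obtain ⟨b, hb, hfb⟩ := exists_odd_part_eq_pow_mul hf hbethe
  have hEeven := eventually_even_of_pow_mul (w := fun x ↦ v (c + x)) hE hE0 hv hκ
  have hfc : Differentiable ℂ fun x ↦ f (c + x) := by fun_prop
  refine ⟨fun x ↦ f (c + x) / E x, fun x ↦ b x / E x, (hfc.analyticAt 0).fun_div hE hE0,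
    hb.fun_div hE hE0, ?_, ?_, ?_⟩
  · filter_upwards [hfb, hEeven] with x h1 h2
    rw [h2, ← sub_div, h1, mul_div_assoc]
  · filter_upwards [hv.filter_mono nhdsWithin_le_nhds] with x h1
    rw [h1, div_div, mul_comm]
  · by_cases h0 : f c = 0
    · refine Or.inr ⟨?_, by simp [h0], ?_⟩
      · by_contra hg
        exact hf0 h0 (by simpa using hbethe 1 le_rfl (by omega))
      · have := (hfc 0).hasDerivAt.fun_div hE.differentiableAt.hasDerivAt hE0
        rw [this.deriv, deriv_comp_const_add]
        simp [h0, hE0, hf0 h0]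
    · exact Or.inl (by simp [h0, hE0])

end HeunBethe

/-- **Theorem 2 (Chalykh, Bethe ansatz for the BC₁ Heun / Treibich–Verdier operator).**
If `k, t₁, …, t_m` satisfy the continuous Bethe ansatz equations and `tᵢ + tⱼ ∉ 2Γ` for
`i ≠ j`, then `φ = ψ/w` with `ψ(z) = e^{kz} ∏ᵢ σ(z + tᵢ)` and `w(z) = ∏_p σ_p(z)^{g_p}`
is an eigenfunction of `H = -d²/dz² + Σ_p g_p(g_p + 1) ℘(z + ω_p)`. -/
theorem betheAnsatz_BC1_heun
    -- the period lattice
    (ω1 ω2 : ℂ) (hind : LinearIndependent ℝ ![ω1, ω2])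
    (η1 η2 : ℂ) (hleg : η1 * ω2 - η2 * ω1 = (Real.pi : ℂ) * Complex.I / 2)
    (ω : Fin 4 → ℂ) (hω : ω = ![0, ω1, ω2, -ω1 - ω2])
    (η : Fin 4 → ℂ) (hη : η = ![0, η1, η2, -η1 - η2])
    -- the Weierstrass sigma function
    (σ : ℂ → ℂ) (hσdiff : Differentiable ℂ σ)
    (hσodd : ∀ z, σ (-z) = -σ z)
    (hσzero : ∀ z, σ z = 0 ↔ ∃ n1 n2 : ℤ, z = 2 * ((n1 : ℂ) * ω1 + (n2 : ℂ) * ω2))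
    (hσsimple : ∀ z, σ z = 0 → deriv σ z ≠ 0)
    (hσnorm : deriv σ 0 = 1)
    (hσper : ∀ s : Fin 4, s = 1 ∨ s = 2 → ∀ z,
      σ (z + 2 * ω s) = -σ z * Complex.exp (2 * η s * (z + ω s)))
    -- the shifted sigma functions σ_r
    (σS : Fin 4 → ℂ → ℂ) (hσS0 : σS 0 = σ)
    (hσSr : ∀ r : Fin 4, r ≠ 0 → ∀ z,
      σS r z = Complex.exp (-η r * z) * σ (z + ω r) / σ (ω r))
    -- the Weierstrass ℘-function ℘ = -(σ'/σ)'
    (P : ℂ → ℂ) (hP : ∀ z, P z = -deriv (fun u => deriv σ u / σ u) z)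
    -- the coupling parameters and the weight w
    (g : Fin 4 → ℕ) (m : ℕ) (hm : m = ∑ p : Fin 4, g p) (hm1 : 1 ≤ m)
    (w : ℂ → ℂ) (hw : ∀ z, w z = ∏ p : Fin 4, σS p z ^ g p)
    -- the Bethe ansatz function ψ and the eigenfunction φ = ψ/w
    (k : ℂ) (t : Fin m → ℂ)
    (ψ : ℂ → ℂ) (hψ : ∀ z, ψ z = Complex.exp (k * z) * ∏ i : Fin m, σ (z + t i))
    (φ : ℂ → ℂ) (hφ : ∀ z, φ z = ψ z / w z)
    -- the continuous Bethe ansatz equations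
    (hBethe : ∀ s : Fin 4, ∀ j : ℕ, 1 ≤ j → j ≤ g s →
      iteratedDeriv (2 * j - 1)
        (fun z => ψ z * Complex.exp (-(m : ℂ) * η s * z)) (ω s) = 0)
    -- the non-degeneracy condition tᵢ + tⱼ ∉ 2Γ
    (ht : ∀ i j : Fin m, i ≠ j →
      ¬∃ n1 n2 : ℤ, t i + t j = 2 * ((n1 : ℂ) * ω1 + (n2 : ℂ) * ω2)) :
    -- conclusion : φ is an eigenfunction of the BC₁ Heun operator
    ∃ ε : ℂ, ∀ z : ℂ, (∀ p : Fin 4, σS p z ≠ 0) →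
      -deriv (deriv φ) z +
        (∑ p : Fin 4, (g p : ℂ) * ((g p : ℂ) + 1) * P (z + ω p)) * φ z = ε * φ z := by
  set L : PeriodPair := ⟨ω1, ω2, hind⟩
  have hω' : ω = ![0, L.ω₁, L.ω₂, -L.ω₁ - L.ω₂] := hω
  have hω0 : ω 0 = 0 := by simp [hω]
  have hη0 : η 0 = 0 := by simp [hη]
  have hzero (z : ℂ) : σ z = 0 ↔ ∃ l ∈ L.lattice, z = 2 * l := by
    rw [hσzero]
    constructor
    · rintro ⟨a, b, h⟩
      exact ⟨_, PeriodPair.mem_lattice.2 ⟨a, b, rfl⟩, h⟩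
    · rintro ⟨l, hl, h⟩
      obtain ⟨a, b, rfl⟩ := PeriodPair.mem_lattice.1 hl
      exact ⟨a, b, h⟩
  have hmult (s : Fin 4) (hs : s = 1 ∨ s = 2) : HeunBethe.HasMultiplier σ (2 * ω s) (2 * η s) := by
    refine ⟨-Complex.exp (2 * η s * ω s), neg_ne_zero.2 (Complex.exp_ne_zero _), fun z ↦ ?_⟩
    rw [hσper s hs, mul_add, Complex.exp_add]
    ring
  have hσ : HeunBethe.IsSigma L ω η σ := by
    refine ⟨hσdiff, hσodd, hzero, hσsimple, fun s ↦ ?_⟩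
    have h1 := hmult 1 (.inl rfl)
    have h2 := hmult 2 (.inr rfl)
    fin_cases s
    · exact ⟨1, one_ne_zero, by simp [hω0, hη0]⟩
    · exact h1
    · exact h2
    · convert h1.neg_period.add_period h2.neg_period using 1
      · simp [hω]; ring
      · simp [hη]; ring
  have hS (p : Fin 4) :
      ∃ c : ℂ, c ≠ 0 ∧ ∀ z, σS p z = c * (Complex.exp (-η p * z) * σ (z + ω p)) := by
    by_cases hp : p = 0
    · subst hp
      exact ⟨1, one_ne_zero, by simp [hσS0, hω0, hη0]⟩
    · have := (hσ.apply_half_period_add_eq_zero_iff hω' (s := 0) (p := p)).not.2 hp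
      rw [hω0, zero_add] at this
      exact ⟨(σ (ω p))⁻¹, inv_ne_zero this, fun z ↦ by rw [hσSr p hp]; ring⟩
  have ht' (i j : Fin m) (hij : i ≠ j) : σ (t i + t j) ≠ 0 := (hσzero _).not.2 (ht i j hij)
  have hmem := HeunBethe.mem_lattice_of_half_period hω'
  have hSne {z : ℂ} (hz : z ∉ L.lattice) (p : Fin 4) : σ (z + ω p) ≠ 0 :=
    hσ.apply_ne_zero_of_notMem hz (hmem p)
  have hwne {z : ℂ} (hz : z ∉ L.lattice) : w z ≠ 0 := by
    rw [hw]
    exact Finset.prod_ne_zero_iff.2 fun p _ ↦ pow_ne_zero _ <|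
      (HeunBethe.IsSigma.shifted_eq_zero_iff hS p z).not.2 (hSne hz p)
  have hψd : Differentiable ℂ ψ := HeunBethe.bethe_differentiable hσ hψ
  have hwd : Differentiable ℂ w := by
    rw [funext hw]
    have := HeunBethe.IsSigma.shifted_differentiable hS hσ
    fun_prop
  have hwper (s : Fin 4) : HeunBethe.HasMultiplier w (2 * ω s) (m * (2 * η s)) := by
    rw [funext hw, hm]
    exact HeunBethe.IsSigma.weight_hasMultiplier hS hσ g s
  have han (z : ℂ) (hz : z ∉ L.lattice) : AnalyticAt ℂ φ z := by
    rw [funext hφ]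
    exact (hψd.analyticAt z).fun_div (hwd.analyticAt z) (hwne hz)
  set u : ℂ → ℂ := fun z ↦ ∑ p, (g p : ℂ) * ((g p : ℂ) + 1) * P (z + ω p) with hu
  have huan (z : ℂ) (hz : z ∉ L.lattice) : AnalyticAt ℂ u z :=
    Finset.analyticAt_fun_sum _ fun p _ ↦ analyticAt_const.fun_mul <|
      (hσ.analyticAt_P hP (hSne hz p)).fun_comp_of_eq (f := fun x ↦ x + ω p) (by fun_prop) rfl
  obtain ⟨ε, hε⟩ : ∃ ε : ℂ, ∀ a, ∀ᶠ z in 𝓝[≠] a,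
      -deriv (deriv φ) z + u z * φ z = ε * φ z := by
    refine HeunBethe.exists_schrodinger_eigenvalue hω' (g := g) (fun s ↦ ?_) han (fun s ↦ ?_)
      (fun z hz h ↦ ?_) (fun a ↦ ?_) huan (fun s z hz ↦ ?_) (fun s ↦ ?_)
    · simpa only [hφ] using (HeunBethe.bethe_hasMultiplier hσ hψ s).div (hwper s)
    · set e : ℂ → ℂ := fun z ↦ Complex.exp (-(m : ℂ) * η s * z) with he
      have hed : Differentiable ℂ e := by fun_prop
      have he0 (z : ℂ) : e z ≠ 0 := Complex.exp_ne_zero _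
      obtain ⟨T, hT, hT0, hwT⟩ := HeunBethe.IsSigma.exists_weight_local hS hσ hω' g s
      obtain ⟨κ, hκ, hwκ⟩ := hwper s
      obtain ⟨κ', hwκ'⟩ := HeunBethe.IsSigma.exists_weight_neg hS hσ g
      simp only [← hw] at hwT hwκ'
      have key := HeunBethe.exists_local_form (f := fun z ↦ ψ z * e z) (v := fun z ↦ w z * e z)
        (c := ω s) (κ := κ * κ' * Complex.exp (-(2 * m * η s * ω s))) (g := g s)
        (hψd.mul hed) (hBethe s) (fun h0 ↦ ?_) (E := fun x ↦ T x * e (ω s + x)) ?_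
        (mul_ne_zero hT0 (he0 _)) ?_ fun x ↦ ?_
      · simpa only [hφ, mul_div_mul_right _ _ (he0 _)] using key
      · have h0 : ψ (ω s) = 0 := by simpa [he0] using h0
        rw [((hψd _).hasDerivAt.fun_mul (hed _).hasDerivAt).deriv, h0, zero_mul, add_zero]
        exact mul_ne_zero (HeunBethe.bethe_deriv_ne_zero hσ hψ ht' (hmem s) h0) (he0 _)
      · have : Differentiable ℂ fun x ↦ e (ω s + x) := by fun_prop
        exact hT.fun_mul (this.analyticAt 0)
      · filter_upwards [hwT] with x hx
        rw [hx, mul_assoc]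
      · have h1 : w (ω s + -x) =
            κ * Complex.exp (m * (2 * η s) * -(ω s + x)) * (κ' * w (ω s + x)) := by
          rw [← hwκ', ← hwκ]
          ring_nf
        have h2 : Complex.exp (m * (2 * η s) * -(ω s + x)) * e (ω s + -x) =
            Complex.exp (-(2 * m * η s * ω s)) * e (ω s + x) := by
          simp only [he, ← Complex.exp_add]
          ring_nf
        simp only [h1]
        linear_combination (κ * κ' * w (ω s + x)) * h2
    · have hz' : -z ∉ L.lattice := by rwa [neg_mem_iff]
      rw [hφ, div_eq_zero_iff, or_iff_left (hwne hz)] at h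
      rw [hφ]
      exact div_ne_zero (HeunBethe.bethe_neg_ne_zero hσ hψ ht' hz h) (hwne hz')
    · filter_upwards [HeunBethe.bethe_eventually_ne_zero hσ hψ a,
        HeunBethe.eventually_notMem_lattice L a] with z h1 h2
      rw [hφ]
      exact div_ne_zero h1 (hwne h2)
    · refine Finset.sum_congr rfl fun p _ ↦ ?_
      rw [add_right_comm, hσ.P_add_two_mul hP s (hSne hz p)]
    · exact hσ.removableAt_potential hω' hP (fun p ↦ (g p : ℂ) * ((g p : ℂ) + 1)) s
  refine ⟨ε, fun z hz ↦ ?_⟩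
  have hzL : z ∉ L.lattice := by
    intro hzL
    obtain ⟨s, a, b, h⟩ := HeunBethe.exists_eq_half_period_add hω' hzL
    refine hz s ((HeunBethe.IsSigma.shifted_eq_zero_iff hS s z).2 ((hzero _).2
      ⟨ω s + (a * L.ω₁ + b * L.ω₂),
        add_mem (hmem s) (PeriodPair.mem_lattice.2 ⟨a, b, rfl⟩), ?_⟩))
    rw [h]
    ring
  have c1 := (han z hzL).deriv.deriv.continuousAt.neg.add
    ((huan z hzL).continuousAt.mul (han z hzL).continuousAt)
  have c2 := (han z hzL).continuousAt.const_mul ε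
  exact ((c1.eventuallyEq_nhds_iff_eventuallyEq_nhdsNE c2).1 (hε z)).eq_of_nhds
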